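/- Suppose the pair (μ₁,μ₂) is perfect and let a, b, c, d : ℕ×ℕ → ℝ (with a_{0,m} = 0 = b_{n,0}) be coefficients satisfying the nearest-neighbor recurrence relations for the multiple orthogonal polynomials P_{n,m}. Then a_{n,m} ≠ 0 for all n ≥ 1, b_{n,m} ≠ 0 for all m ≥ 1, c_{n,m} ≠ d_{n,m} for all n,m ≥ 0, and the coefficients satisfy the discrete system: (c_{n,m+1} − c_{n,m})(c_{n,m} − d_{n,m}) = (a_{n+1,m} + b_{n+1,m}) − (a_{n,m+1} + b_{n,m+1}); (d_{n+1,m} − d_{n,m})(c_{n,m} − d_{n,m}) = (a_{n+1,m} + b_{n+1,m}) − (a_{n,m+1} + b_{n,m+1}); a_{n,m+1}(c_{n−1,m} − d_{n−1,m}) = a_{n,m}(c_{n,m} − d_{n,m}) for n ≥ 1; and b_{n+1,m}(c_{n,m−1} − d_{n,m−1}) = b_{n,m}(c_{n,m} − d_{n,m}) for m ≥ 1. -/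

import Mathlib

open MeasureTheory Polynomial

/-- The `k`-th moment of a measure `μ` on `ℝ`. -/
noncomputable def mom (μ : Measure ℝ) (k : ℕ) : ℝ := ∫ x, x ^ k ∂μ

/-- The `(n+m)×(n+m)` moment matrix of the pair `(μ₁, μ₂)`: column `j` contains the
moments `s_{i+j}^{(1)}` for `j < n` and `s_{i+j-n}^{(2)}` for `n ≤ j < n+m`. -/
noncomputable def Smat (μ₁ μ₂ : Measure ℝ) (n m : ℕ) :
    Matrix (Fin (n + m)) (Fin (n + m)) ℝ :=
  Matrix.of fun i j =>
    if (j : ℕ) < n then mom μ₁ ((i : ℕ) + (j : ℕ))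
    else mom μ₂ ((i : ℕ) + (j : ℕ) - n)

/-- The determinant `S_{n,m}` (with `S_{0,0} = 1`). -/
noncomputable def Sdet (μ₁ μ₂ : Measure ℝ) (n m : ℕ) : ℝ := (Smat μ₁ μ₂ n m).det

/-- The `(n+m+1)×(n+m+1)` matrix over `ℝ[x]` whose determinant (normalized by `S_{n,m}`)
gives the multiple orthogonal polynomial `P_{n,m}`. -/
noncomputable def Pmat (μ₁ μ₂ : Measure ℝ) (n m : ℕ) :
    Matrix (Fin (n + m + 1)) (Fin (n + m + 1)) (Polynomial ℝ) :=
  Matrix.of fun i j =>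
    if (j : ℕ) < n then C (mom μ₁ ((i : ℕ) + (j : ℕ)))
    else if (j : ℕ) < n + m then C (mom μ₂ ((i : ℕ) + (j : ℕ) - n))
    else X ^ (i : ℕ)

/-- The multiple orthogonal (Hermite–Padé) polynomial `P_{n,m}`. -/
noncomputable def Ppoly (μ₁ μ₂ : Measure ℝ) (n m : ℕ) : Polynomial ℝ :=
  (Sdet μ₁ μ₂ n m)⁻¹ • (Pmat μ₁ μ₂ n m).det

/-- The linear functional on polynomials sending `X ^ k` to the `k`-th moment of `μ`. -/
noncomputable def momentFunctional (μ : Measure ℝ) : ℝ[X] →ₗ[ℝ] ℝ :=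
  Polynomial.lsum fun k => mom μ k • LinearMap.id

theorem momentFunctional_C_mul_X_pow (μ : Measure ℝ) (r : ℝ) (k : ℕ) :
    momentFunctional μ (C r * X ^ k) = r * mom μ k := by
  rw [momentFunctional, C_mul_X_pow_eq_monomial, lsum_apply,
    sum_monomial_index r _ (map_zero (mom μ k • LinearMap.id)),
    LinearMap.smul_apply, LinearMap.id_apply, smul_eq_mul, mul_comm]

theorem momentFunctional_X_pow_mul_C_mul (μ : Measure ℝ) (k : ℕ) (r : ℝ) (p : ℝ[X]) :
    momentFunctional μ (X ^ k * (C r * p)) = r * momentFunctional μ (X ^ k * p) := by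
  rw [show X ^ k * (C r * p) = r • (X ^ k * p) by rw [smul_eq_C_mul]; ring, map_smul, smul_eq_mul]

theorem momentFunctional_X_pow_mul_sum (μ : Measure ℝ) (k N : ℕ) (w : Fin N → ℝ) :
    momentFunctional μ (X ^ k * ∑ i, C (w i) * X ^ (i : ℕ)) = ∑ i, w i * mom μ (i + k) := by
  rw [Finset.mul_sum, map_sum]
  refine Finset.sum_congr rfl fun i _ => ?_
  rw [← momentFunctional_C_mul_X_pow, pow_add]
  congr 1
  ring

/-- The first `n + m` columns of the matrix `Pmat`, with the last column replaced by `v`. -/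
def borderedMat {R : Type*} (s t : ℕ → R) (n m : ℕ) (v : Fin (n + m + 1) → R) :
    Matrix (Fin (n + m + 1)) (Fin (n + m + 1)) R :=
  Matrix.of fun i j =>
    if (j : ℕ) < n then s ((i : ℕ) + (j : ℕ))
    else if (j : ℕ) < n + m then t ((i : ℕ) + (j : ℕ) - n)
    else v i

/-- The cofactors of the last column of `borderedMat`. -/
noncomputable def borderCofactor {R : Type*} [CommRing R] (s t : ℕ → R) (n m : ℕ)
    (i : Fin (n + m + 1)) : R :=
  (-1) ^ ((i : ℕ) + (n + m)) * Matrix.det (Matrix.of fun k l : Fin (n + m) =>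
    if (l : ℕ) < n then s ((i.succAbove k : ℕ) + (l : ℕ))
    else t ((i.succAbove k : ℕ) + (l : ℕ) - n))

theorem det_borderedMat {R : Type*} [CommRing R] (s t : ℕ → R) (n m : ℕ)
    (v : Fin (n + m + 1) → R) :
    (borderedMat s t n m v).det = ∑ i, borderCofactor s t n m i * v i := by
  rw [Matrix.det_succ_column _ (Fin.last (n + m))]
  refine Finset.sum_congr rfl fun i _ => ?_
  have hv : borderedMat s t n m v i (Fin.last (n + m)) = v i := by
    simp [borderedMat]
  rw [hv, borderCofactor, Fin.val_last, mul_right_comm]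
  congr 3
  ext k l
  simp [borderedMat]

theorem borderCofactor_map {R S : Type*} [CommRing R] [CommRing S] (f : R →+* S) (s t : ℕ → R)
    (n m : ℕ) (i : Fin (n + m + 1)) :
    borderCofactor (fun k => f (s k)) (fun k => f (t k)) n m i = f (borderCofactor s t n m i) := by
  simp only [borderCofactor, map_mul, map_pow, map_neg, map_one, RingHom.map_det]
  congr 2
  ext k l
  simp [apply_ite f]

theorem borderCofactor_last (μ₁ μ₂ : Measure ℝ) (n m : ℕ) :
    borderCofactor (mom μ₁) (mom μ₂) n m (Fin.last (n + m)) = Sdet μ₁ μ₂ n m := by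
  simp [borderCofactor, Sdet, Smat]

theorem det_Pmat (μ₁ μ₂ : Measure ℝ) (n m : ℕ) :
    (Pmat μ₁ μ₂ n m).det =
      ∑ i : Fin (n + m + 1), C (borderCofactor (mom μ₁) (mom μ₂) n m i) * X ^ (i : ℕ) := by
  have h := det_borderedMat (fun k => C (mom μ₁ k)) (fun k => C (mom μ₂ k)) n m
    (fun i => X ^ (i : ℕ))
  simp only [borderCofactor_map] at h
  exact h

theorem Ppoly_coeff_of_lt (μ₁ μ₂ : Measure ℝ) {n m k : ℕ} (hk : n + m < k) :
    (Ppoly μ₁ μ₂ n m).coeff k = 0 := by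
  rw [Ppoly, det_Pmat, coeff_smul, finsetSum_coeff, Finset.sum_eq_zero, smul_zero]
  intro i _
  rw [coeff_C_mul_X_pow, if_neg (by have := i.2; omega)]

theorem Ppoly_coeff_add (μ₁ μ₂ : Measure ℝ) {n m : ℕ} (h : Sdet μ₁ μ₂ n m ≠ 0) :
    (Ppoly μ₁ μ₂ n m).coeff (n + m) = 1 := by
  rw [Ppoly, det_Pmat, coeff_smul, finsetSum_coeff, Finset.sum_eq_single (Fin.last (n + m))]
  · simp [borderCofactor_last, h, coeff_X_pow]
  · intro i _ hi
    rw [coeff_C_mul_X_pow, if_neg fun e => hi (Fin.ext e.symm)]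
  · simp

theorem momentFunctional_X_pow_mul_Ppoly (μ μ₁ μ₂ : Measure ℝ) (n m k : ℕ) :
    momentFunctional μ (X ^ k * Ppoly μ₁ μ₂ n m) = (Sdet μ₁ μ₂ n m)⁻¹ *
      (borderedMat (mom μ₁) (mom μ₂) n m fun i => mom μ (i + k)).det := by
  rw [Ppoly, det_Pmat, mul_smul_comm, map_smul, momentFunctional_X_pow_mul_sum, det_borderedMat,
    smul_eq_mul]

theorem momentFunctional_X_pow_mul_Ppoly_fst (μ₁ μ₂ : Measure ℝ) {n m k : ℕ} (hk : k < n) :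
    momentFunctional μ₁ (X ^ k * Ppoly μ₁ μ₂ n m) = 0 := by
  rw [momentFunctional_X_pow_mul_Ppoly, Matrix.det_zero_of_column_eq
    (i := ⟨k, by omega⟩) (j := Fin.last (n + m)) (by simp [Fin.ext_iff]; omega), mul_zero]
  intro i
  simp [borderedMat, hk]

theorem momentFunctional_X_pow_mul_Ppoly_snd (μ₁ μ₂ : Measure ℝ) {n m k : ℕ} (hk : k < m) :
    momentFunctional μ₂ (X ^ k * Ppoly μ₁ μ₂ n m) = 0 := by
  rw [momentFunctional_X_pow_mul_Ppoly, Matrix.det_zero_of_column_eq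
    (i := ⟨n + k, by omega⟩) (j := Fin.last (n + m)) (by simp [Fin.ext_iff]; omega), mul_zero]
  intro i
  simp only [borderedMat, Matrix.of_apply, Fin.val_last]
  rw [if_neg (by omega), if_pos (by omega), if_neg (by omega), if_neg (by omega)]
  congr 1
  omega

/-- Regularity of `S_{n,m}` makes the orthogonality conditions of index `(n, m)` determining in
degree less than `n + m`. -/
theorem eq_zero_of_momentFunctional_eq_zero {μ₁ μ₂ : Measure ℝ} {n m : ℕ}
    (h : Sdet μ₁ μ₂ n m ≠ 0) {q : ℝ[X]} (hq : q.degree < (n + m : ℕ))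
    (hfst : ∀ k < n, momentFunctional μ₁ (X ^ k * q) = 0)
    (hsnd : ∀ k < m, momentFunctional μ₂ (X ^ k * q) = 0) : q = 0 := by
  have hsum : q = ∑ i : Fin (n + m), C (q.coeff i) * X ^ (i : ℕ) := by
    rw [Fin.sum_univ_eq_sum_range (fun i => C (q.coeff i) * X ^ i)]
    ext k
    simp only [finsetSum_coeff, coeff_C_mul_X_pow, Finset.sum_ite_eq, Finset.mem_range]
    split_ifs with hk
    · rfl
    · exact coeff_eq_zero_of_degree_lt (hq.trans_le (by exact_mod_cast not_lt.mp hk))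
  have hw : (fun i : Fin (n + m) => q.coeff i) = 0 := by
    refine Matrix.eq_zero_of_vecMul_eq_zero h ?_
    ext j
    simp only [Matrix.vecMul, dotProduct, Smat, Matrix.of_apply, Pi.zero_apply]
    by_cases hj : (j : ℕ) < n
    · have := hfst j hj
      rw [hsum, momentFunctional_X_pow_mul_sum] at this
      simpa [hj] using this
    · have := hsnd (j - n) (by omega)
      rw [hsum, momentFunctional_X_pow_mul_sum] at this
      rw [← this]
      refine Finset.sum_congr rfl fun i _ => ?_
      rw [if_neg hj, Nat.add_sub_assoc (not_lt.mp hj)]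
  rw [hsum]
  exact Finset.sum_eq_zero fun i _ => by rw [show q.coeff i = 0 from congrFun hw i]; simp

theorem Ppoly_ne_zero {μ₁ μ₂ : Measure ℝ} {n m : ℕ} (h : Sdet μ₁ μ₂ n m ≠ 0) :
    Ppoly μ₁ μ₂ n m ≠ 0 := fun h0 => by
  simpa [h0] using Ppoly_coeff_add μ₁ μ₂ h

theorem degree_Ppoly_lt (μ₁ μ₂ : Measure ℝ) {n m N : ℕ} (hN : n + m < N) :
    (Ppoly μ₁ μ₂ n m).degree < N :=
  (degree_lt_iff_coeff_zero _ _).2 fun _ hk => Ppoly_coeff_of_lt μ₁ μ₂ (hN.trans_le hk)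

theorem momentFunctional_X_pow_mul_Ppoly_fst_ne_zero {μ₁ μ₂ : Measure ℝ} {n m : ℕ}
    (h : Sdet μ₁ μ₂ n m ≠ 0) (h' : Sdet μ₁ μ₂ (n + 1) m ≠ 0) :
    momentFunctional μ₁ (X ^ n * Ppoly μ₁ μ₂ n m) ≠ 0 := fun h0 =>
  Ppoly_ne_zero h <| eq_zero_of_momentFunctional_eq_zero h'
    (degree_Ppoly_lt μ₁ μ₂ (by omega))
    (fun k hk => by
      obtain hk | rfl := Nat.lt_succ_iff_lt_or_eq.1 hk
      · exact momentFunctional_X_pow_mul_Ppoly_fst μ₁ μ₂ hk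
      · exact h0)
    (fun k hk => momentFunctional_X_pow_mul_Ppoly_snd μ₁ μ₂ hk)

theorem momentFunctional_X_pow_mul_Ppoly_snd_ne_zero {μ₁ μ₂ : Measure ℝ} {n m : ℕ}
    (h : Sdet μ₁ μ₂ n m ≠ 0) (h' : Sdet μ₁ μ₂ n (m + 1) ≠ 0) :
    momentFunctional μ₂ (X ^ m * Ppoly μ₁ μ₂ n m) ≠ 0 := fun h0 =>
  Ppoly_ne_zero h <| eq_zero_of_momentFunctional_eq_zero h'
    (degree_Ppoly_lt μ₁ μ₂ (by omega))
    (fun k hk => momentFunctional_X_pow_mul_Ppoly_fst μ₁ μ₂ hk)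
    (fun k hk => by
      obtain hk | rfl := Nat.lt_succ_iff_lt_or_eq.1 hk
      · exact momentFunctional_X_pow_mul_Ppoly_snd μ₁ μ₂ hk
      · exact h0)

/-- Comparison of the two leading coefficients in the compatibility condition of the
nearest-neighbor recurrences for monic polynomials `P n m` of degree `n + m`. -/
theorem recurrence_compatibility {R : Type*} [CommRing R] {P : ℕ → ℕ → R[X]}
    (hlt : ∀ n m k, n + m < k → (P n m).coeff k = 0) (hlead : ∀ n m, (P n m).coeff (n + m) = 1)
    {a b c d : ℕ → ℕ → R} (ha0 : ∀ m, a 0 m = 0) (hb0 : ∀ n, b n 0 = 0)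
    (hrec1 : ∀ n m : ℕ, P (n + 1) m = (X - C (c n m)) * P n m
      - (if n = 0 then 0 else C (a n m) * P (n - 1) m)
      - (if m = 0 then 0 else C (b n m) * P n (m - 1)))
    (hrec2 : ∀ n m : ℕ, P n (m + 1) = (X - C (d n m)) * P n m
      - (if n = 0 then 0 else C (a n m) * P (n - 1) m)
      - (if m = 0 then 0 else C (b n m) * P n (m - 1)))
    (n m : ℕ) :
    c n (m + 1) - c n m = d (n + 1) m - d n m ∧
    (c n (m + 1) - c n m) * (c n m - d n m)
      = (a (n + 1) m + b (n + 1) m) - (a n (m + 1) + b n (m + 1)) := by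
  let A : ℕ → ℕ → R[X] := fun n m => if n = 0 then 0 else C (a n m) * P (n - 1) m
  let B : ℕ → ℕ → R[X] := fun n m => if m = 0 then 0 else C (b n m) * P n (m - 1)
  have hA : ∀ n m k, n + m < k + 1 → (A n m).coeff k = 0 := by
    intro n m k hk
    rcases n with _ | n
    · simp [A]
    · simp [A, hlt n m k (by omega)]
  have hB : ∀ n m k, n + m < k + 1 → (B n m).coeff k = 0 := by
    intro n m k hk
    rcases m with _ | m
    · simp [B]
    · simp [B, hlt n m k (by omega)]
  have hA' : ∀ n m k, n + m = k + 1 → (A n m).coeff k = a n m := by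
    intro n m k hk
    rcases n with _ | n
    · simp [A, ha0]
    · obtain rfl : k = n + m := by omega
      simp [A, hlead]
  have hB' : ∀ n m k, n + m = k + 1 → (B n m).coeff k = b n m := by
    intro n m k hk
    rcases m with _ | m
    · simp [B, hb0]
    · obtain rfl : k = n + m := by omega
      simp [B, hlead]
  have hc : ∀ n m, P (n + 1) m = (X - C (c n m)) * P n m - A n m - B n m := hrec1
  have hd : ∀ n m, P n (m + 1) = (X - C (d n m)) * P n m - A n m - B n m := hrec2
  have key : C (c n m - d n m + d (n + 1) m - c n (m + 1)) * P (n + 1) m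
      + C ((c n m - d n m) * (c n m - c n (m + 1))) * P n m
      + C (c n m - d n m) * (A n m + B n m)
      - A n (m + 1) - B n (m + 1) + A (n + 1) m + B (n + 1) m = 0 := by
    simp only [map_add, map_sub, map_mul]
    linear_combination (hd (n + 1) m) - (hc n (m + 1)) + (C (c n m) - C (d n m)) * (hc n m)
      + (X - C (c n (m + 1))) * (hc n m - hd n m)
  have htop := congrArg (coeff · (n + m + 1)) key
  simp only [coeff_add, coeff_sub, coeff_C_mul, coeff_zero] at htop
  rw [hlt n m _ (by omega), show n + m + 1 = n + 1 + m by omega, hlead, hA _ _ _ (by omega),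
    hB _ _ _ (by omega), hA _ _ _ (by omega), hB _ _ _ (by omega), hA _ _ _ (by omega),
    hB _ _ _ (by omega)] at htop
  have hcd : c n m - d n m + d (n + 1) m - c n (m + 1) = 0 := by linear_combination htop
  have hsub := congrArg (coeff · (n + m)) key
  simp only [hcd, coeff_add, coeff_sub, coeff_C_mul, coeff_zero] at hsub
  rw [hlead, hA _ _ _ (by omega), hB _ _ _ (by omega), hA' _ _ _ (by omega),
    hB' _ _ _ (by omega), hA' _ _ _ (by omega), hB' _ _ _ (by omega)] at hsub
  exact ⟨by linear_combination -hcd, by linear_combination -hsub⟩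

/-- For a perfect system, the coefficients of the nearest-neighbor recurrence relations
are nondegenerate (`a_{n,m} ≠ 0` for `n ≥ 1`, `b_{n,m} ≠ 0` for `m ≥ 1`,
`c_{n,m} ≠ d_{n,m}`) and satisfy the discrete (zero curvature) system. -/
theorem recurrence_coefficients_satisfy_discrete_system (μ₁ μ₂ : Measure ℝ)
    (h₁ : ∀ k : ℕ, Integrable (fun x => x ^ k) μ₁)
    (h₂ : ∀ k : ℕ, Integrable (fun x => x ^ k) μ₂)
    (hperfect : ∀ n m : ℕ, Sdet μ₁ μ₂ n m ≠ 0)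
    (a b c d : ℕ → ℕ → ℝ)
    (ha0 : ∀ m, a 0 m = 0) (hb0 : ∀ n, b n 0 = 0)
    (hrec1 : ∀ n m : ℕ,
      Ppoly μ₁ μ₂ (n + 1) m =
        (X - C (c n m)) * Ppoly μ₁ μ₂ n m
          - (if n = 0 then 0 else C (a n m) * Ppoly μ₁ μ₂ (n - 1) m)
          - (if m = 0 then 0 else C (b n m) * Ppoly μ₁ μ₂ n (m - 1)))
    (hrec2 : ∀ n m : ℕ,
      Ppoly μ₁ μ₂ n (m + 1) =
        (X - C (d n m)) * Ppoly μ₁ μ₂ n m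
          - (if n = 0 then 0 else C (a n m) * Ppoly μ₁ μ₂ (n - 1) m)
          - (if m = 0 then 0 else C (b n m) * Ppoly μ₁ μ₂ n (m - 1))) :
    (∀ n m : ℕ, 1 ≤ n → a n m ≠ 0) ∧
    (∀ n m : ℕ, 1 ≤ m → b n m ≠ 0) ∧
    (∀ n m : ℕ, c n m ≠ d n m) ∧
    (∀ n m : ℕ, (c n (m + 1) - c n m) * (c n m - d n m)
      = (a (n + 1) m + b (n + 1) m) - (a n (m + 1) + b n (m + 1))) ∧
    (∀ n m : ℕ, (d (n + 1) m - d n m) * (c n m - d n m)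
      = (a (n + 1) m + b (n + 1) m) - (a n (m + 1) + b n (m + 1))) ∧
    (∀ n m : ℕ, 1 ≤ n →
      a n (m + 1) * (c (n - 1) m - d (n - 1) m) = a n m * (c n m - d n m)) ∧
    (∀ n m : ℕ, 1 ≤ m →
      b (n + 1) m * (c n (m - 1) - d n (m - 1)) = b n m * (c n m - d n m)) := by
  let P := Ppoly μ₁ μ₂
  let h : ℕ → ℕ → ℝ := fun n m => momentFunctional μ₁ (X ^ n * P n m)
  let k : ℕ → ℕ → ℝ := fun n m => momentFunctional μ₂ (X ^ m * P n m)
  have hh : ∀ n m, h n m ≠ 0 := fun n m =>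
    momentFunctional_X_pow_mul_Ppoly_fst_ne_zero (hperfect n m) (hperfect (n + 1) m)
  have hk : ∀ n m, k n m ≠ 0 := fun n m =>
    momentFunctional_X_pow_mul_Ppoly_snd_ne_zero (hperfect n m) (hperfect n (m + 1))
  have hP₁ : ∀ {n m l : ℕ}, l < n → momentFunctional μ₁ (X ^ l * P n m) = 0 :=
    fun hl => momentFunctional_X_pow_mul_Ppoly_fst μ₁ μ₂ hl
  have hP₂ : ∀ {n m l : ℕ}, l < m → momentFunctional μ₂ (X ^ l * P n m) = 0 :=
    fun hl => momentFunctional_X_pow_mul_Ppoly_snd μ₁ μ₂ hl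
  have hah : ∀ n m, a (n + 1) m * h n m = h (n + 1) m := by
    intro n m
    have hX : X ^ (n + 1) * P (n + 1) m = X ^ n * P (n + 1 + 1) m
        + X ^ n * (C (c (n + 1) m) * P (n + 1) m) + X ^ n * (C (a (n + 1) m) * P n m)
        + X ^ n * (if m = 0 then 0 else C (b (n + 1) m) * P (n + 1) (m - 1)) := by
      have := hrec1 (n + 1) m
      rw [if_neg n.succ_ne_zero, Nat.add_sub_cancel] at this
      linear_combination (-X ^ n) * this
    have hL := congrArg (momentFunctional μ₁) hX
    have hB : momentFunctional μ₁
        (X ^ n * (if m = 0 then 0 else C (b (n + 1) m) * P (n + 1) (m - 1))) = 0 := by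
      split_ifs
      · simp
      · rw [momentFunctional_X_pow_mul_C_mul, hP₁ (by omega), mul_zero]
    rw [map_add, map_add, map_add, hB, momentFunctional_X_pow_mul_C_mul,
      momentFunctional_X_pow_mul_C_mul, hP₁ (l := n) (n := n + 1 + 1) (by omega),
      hP₁ (l := n) (n := n + 1) (by omega)] at hL
    linear_combination -hL
  have hbk : ∀ n m, b n (m + 1) * k n m = k n (m + 1) := by
    intro n m
    have hX : X ^ (m + 1) * P n (m + 1) = X ^ m * P n (m + 1 + 1)
        + X ^ m * (C (d n (m + 1)) * P n (m + 1)) + X ^ m * (C (b n (m + 1)) * P n m)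
        + X ^ m * (if n = 0 then 0 else C (a n (m + 1)) * P (n - 1) (m + 1)) := by
      have := hrec2 n (m + 1)
      rw [if_neg m.succ_ne_zero, Nat.add_sub_cancel] at this
      linear_combination (-X ^ m) * this
    have hL := congrArg (momentFunctional μ₂) hX
    have hA : momentFunctional μ₂
        (X ^ m * (if n = 0 then 0 else C (a n (m + 1)) * P (n - 1) (m + 1))) = 0 := by
      split_ifs
      · simp
      · rw [momentFunctional_X_pow_mul_C_mul, hP₂ (by omega), mul_zero]
    rw [map_add, map_add, map_add, hA, momentFunctional_X_pow_mul_C_mul,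
      momentFunctional_X_pow_mul_C_mul, hP₂ (l := m) (m := m + 1 + 1) (by omega),
      hP₂ (l := m) (m := m + 1) (by omega)] at hL
    linear_combination -hL
  have hdiff : ∀ n m, P n (m + 1) = P (n + 1) m + C (c n m - d n m) * P n m := by
    intro n m
    rw [map_sub]
    linear_combination hrec2 n m - hrec1 n m
  have hch : ∀ n m, (c n m - d n m) * h n m = h n (m + 1) := by
    intro n m
    have hL := congrArg (fun p => momentFunctional μ₁ (X ^ n * p)) (hdiff n m)
    simp only [mul_add, map_add, momentFunctional_X_pow_mul_C_mul] at hL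
    rw [hP₁ (Nat.lt_succ_self n)] at hL
    linear_combination -hL
  have hck : ∀ n m, (c n m - d n m) * k n m = -k (n + 1) m := by
    intro n m
    have hL := congrArg (fun p => momentFunctional μ₂ (X ^ m * p)) (hdiff n m)
    simp only [mul_add, map_add, momentFunctional_X_pow_mul_C_mul] at hL
    rw [hP₂ (Nat.lt_succ_self m)] at hL
    linear_combination -hL
  have hcomp := recurrence_compatibility (P := P) (fun n m l hl => Ppoly_coeff_of_lt μ₁ μ₂ hl)
    (fun n m => Ppoly_coeff_add μ₁ μ₂ (hperfect n m)) ha0 hb0 hrec1 hrec2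
  refine ⟨?_, ?_, ?_, fun n m => (hcomp n m).2, fun n m => (hcomp n m).1 ▸ (hcomp n m).2, ?_, ?_⟩
  · rintro (_ | n) m hn h0
    · omega
    · exact hh (n + 1) m (by rw [← hah, h0, zero_mul])
  · rintro n (_ | m) hm h0
    · omega
    · exact hk n (m + 1) (by rw [← hbk, h0, zero_mul])
  · intro n m h0
    exact hh n (m + 1) (by rw [← hch, h0, sub_self, zero_mul])
  · rintro (_ | n) m hn
    · omega
    · rw [Nat.add_sub_cancel]
      refine mul_right_cancel₀ (hh n m) ?_
      linear_combination a (n + 1) (m + 1) * hch n m + hah n (m + 1) - hch (n + 1) m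
        - (c (n + 1) m - d (n + 1) m) * hah n m
  · rintro n (_ | m) hm
    · omega
    · rw [Nat.add_sub_cancel]
      refine mul_right_cancel₀ (hk n m) ?_
      linear_combination b (n + 1) (m + 1) * hck n m - hbk (n + 1) m - hck n (m + 1)
        - (c n (m + 1) - d n (m + 1)) * hbk n m
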